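/- Assume: (a) there is a ≥ 0 such that −(1/n)·log μ(P^{(n)}(x)) → a as n → ∞ for m-a.e. x ∈ [0,1); (b) there is b > 0 such that −(1/n)·log ν(P^{(n)}(x)) → b as n → ∞ for m-a.e. x ∈ [0,1); (c) there exists C > 1 such that for every n ≥ 0, every Δ ∈ 𝒫^{(n)} and all Δ₁, Δ₂ ∈ 𝒫^{(n+1)} with Δ₁, Δ₂ ⊆ Δ one has max{μ(Δ₁)/μ(Δ₂), μ(Δ)/μ(Δ₁), ν(Δ₁)/ν(Δ₂), ν(Δ)/ν(Δ₁), m(Δ)/m(Δ₁)} ≤ C; (d) ⋂_{n≥1} P^{(n)}(x) = {x} for m-a.e. x ∈ [0,1); (e) for every n ≥ 0, every element of 𝒫^{(n)} is the union of at least 3 distinct elements of 𝒫^{(n+1)}. Then for m-a.e. x ∈ [0,1), lim_{ε→0⁺} log μ((x−ε, x+ε)) / log ν((x−ε, x+ε)) = a/b. In particular, if m = μ and ν is the Lebesgue measure on [0,1), then dim_H(μ) = a/b. -/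

import Mathlib

open MeasureTheory Filter
open scoped ENNReal

/-- `J` is an atom of the `n`-th partition encoded by the atom function `P`. -/
def AtomOf (P : ℕ → ℝ → Set ℝ) (n : ℕ) (J : Set ℝ) : Prop :=
  ∃ y ∈ Set.Ico (0 : ℝ) 1, J = P n y

/-- `P : ℕ → ℝ → Set ℝ` encodes a refining sequence of finite partitions of `[0,1)`
into left-closed right-open intervals: `P n x` is the atom of the `n`-th partition
containing `x`. -/
def PartitionFamily (P : ℕ → ℝ → Set ℝ) : Prop :=
  (∀ n : ℕ, ∀ x ∈ Set.Ico (0 : ℝ) 1, x ∈ P n x) ∧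
  (∀ n : ℕ, ∀ x ∈ Set.Ico (0 : ℝ) 1, ∃ a b : ℝ, a < b ∧ P n x = Set.Ico a b ∧
      Set.Ico a b ⊆ Set.Ico (0 : ℝ) 1) ∧
  (∀ n : ℕ, ∀ x ∈ Set.Ico (0 : ℝ) 1, ∀ y ∈ P n x, P n y = P n x) ∧
  (∀ n : ℕ, {J : Set ℝ | AtomOf P n J}.Finite) ∧
  (∀ n : ℕ, ∀ x ∈ Set.Ico (0 : ℝ) 1, P (n + 1) x ⊆ P n x)

/-- The Hausdorff dimension of a Borel probability measure on `ℝ`. -/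
noncomputable def measureHausdorffDim (μ : Measure ℝ) : ℝ≥0∞ :=
  ⨅ (E : Set ℝ) (_ : MeasurableSet E) (_ : μ E = 1), dimH E

open scoped NNReal

/-- The measure of an atom is at most `C` times that of any of its children. -/
def ChildComparable (P : ℕ → ℝ → Set ℝ) (C : ℝ) (lam : Measure ℝ) : Prop :=
  ∀ n : ℕ, ∀ x ∈ Set.Ico (0 : ℝ) 1, ∀ y ∈ Set.Ico (0 : ℝ) 1, P (n + 1) y ⊆ P n x →
    lam.real (P n x) ≤ C * lam.real (P (n + 1) y)

/-- Every atom contains two distinct atoms of the next generation. -/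
def SplitsAtomsInTwo (P : ℕ → ℝ → Set ℝ) : Prop :=
  ∀ n : ℕ, ∀ x ∈ Set.Ico (0 : ℝ) 1, ∃ y ∈ Set.Ico (0 : ℝ) 1, ∃ z ∈ Set.Ico (0 : ℝ) 1,
    P (n + 1) y ⊆ P n x ∧ P (n + 1) z ⊆ P n x ∧ P (n + 1) y ≠ P (n + 1) z

theorem one_sub_one_div_pos {C : ℝ} (hC : 1 < C) : 0 < 1 - 1 / C := by
  rw [sub_pos, div_lt_one (by linarith)]
  exact hC

theorem measureReal_le_mul_of_div_le {lam : Measure ℝ} [IsFiniteMeasure lam] {C : ℝ} (hC : 0 ≤ C)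
    {s t : Set ℝ} (h : lam s / lam t ≤ ENNReal.ofReal C) : lam.real s ≤ C * lam.real t := by
  rw [ENNReal.div_le_iff_le_mul (Or.inr ENNReal.ofReal_ne_top)
    (Or.inl (measure_ne_top _ _))] at h
  have := ENNReal.toReal_mono
    (ENNReal.mul_ne_top ENNReal.ofReal_ne_top (measure_ne_top lam t)) h
  rwa [ENNReal.toReal_mul, ENNReal.toReal_ofReal hC] at this

namespace PartitionFamily

variable {P : ℕ → ℝ → Set ℝ}

theorem mem_self (hP : PartitionFamily P) (n : ℕ) {x : ℝ} (hx : x ∈ Set.Ico (0 : ℝ) 1) :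
    x ∈ P n x := hP.1 n x hx

theorem eq_of_mem (hP : PartitionFamily P) {n : ℕ} {x y : ℝ} (hx : x ∈ Set.Ico (0 : ℝ) 1)
    (hy : y ∈ P n x) : P n y = P n x := hP.2.2.1 n x hx y hy

theorem subset_Ico (hP : PartitionFamily P) (n : ℕ) {x : ℝ} (hx : x ∈ Set.Ico (0 : ℝ) 1) :
    P n x ⊆ Set.Ico 0 1 := by
  obtain ⟨l, r, -, h, h'⟩ := hP.2.1 n x hx
  rwa [h]

theorem antitone (hP : PartitionFamily P) {x : ℝ} (hx : x ∈ Set.Ico (0 : ℝ) 1) :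
    Antitone fun n => P n x :=
  antitone_nat_of_succ_le fun n => hP.2.2.2.2 n x hx

theorem finite_atoms (hP : PartitionFamily P) (n : ℕ) : {J : Set ℝ | AtomOf P n J}.Finite :=
  hP.2.2.2.1 n

theorem measurableSet (hP : PartitionFamily P) (n : ℕ) {x : ℝ} (hx : x ∈ Set.Ico (0 : ℝ) 1) :
    MeasurableSet (P n x) := by
  obtain ⟨l, r, -, h, -⟩ := hP.2.1 n x hx
  rw [h]
  exact measurableSet_Ico

theorem eq_of_not_disjoint (hP : PartitionFamily P) {n : ℕ} {x y : ℝ}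
    (hx : x ∈ Set.Ico (0 : ℝ) 1) (hy : y ∈ Set.Ico (0 : ℝ) 1)
    (h : ¬ Disjoint (P n x) (P n y)) : P n x = P n y := by
  obtain ⟨z, hzx, hzy⟩ := Set.not_disjoint_iff.1 h
  rw [← hP.eq_of_mem hx hzx, hP.eq_of_mem hy hzy]

/-- An atom is the interval between its infimum and its supremum. -/
theorem eq_Ico (hP : PartitionFamily P) (n : ℕ) {x : ℝ} (hx : x ∈ Set.Ico (0 : ℝ) 1) :
    P n x = Set.Ico (sInf (P n x)) (sSup (P n x)) ∧ sInf (P n x) < sSup (P n x) := by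
  obtain ⟨l, r, hlr, h, -⟩ := hP.2.1 n x hx
  rw [h, csInf_Ico hlr, csSup_Ico hlr]
  exact ⟨rfl, hlr⟩

theorem eq_of_sSup_eq (hP : PartitionFamily P) {n : ℕ} {x y : ℝ}
    (hx : x ∈ Set.Ico (0 : ℝ) 1) (hy : y ∈ Set.Ico (0 : ℝ) 1)
    (h : sSup (P n x) = sSup (P n y)) : P n x = P n y := by
  obtain ⟨hx₁, hx₂⟩ := hP.eq_Ico n hx
  obtain ⟨hy₁, hy₂⟩ := hP.eq_Ico n hy
  refine hP.eq_of_not_disjoint hx hy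
    (Set.not_disjoint_iff.2 ⟨max (sInf (P n x)) (sInf (P n y)), ?_, ?_⟩)
  · exact hx₁.symm.subset ⟨le_max_left _ _, max_lt hx₂ (h ▸ hy₂)⟩
  · exact hy₁.symm.subset ⟨le_max_right _ _, max_lt (h ▸ hx₂) hy₂⟩

theorem eq_of_sInf_eq (hP : PartitionFamily P) {n : ℕ} {x y : ℝ}
    (hx : x ∈ Set.Ico (0 : ℝ) 1) (hy : y ∈ Set.Ico (0 : ℝ) 1)
    (h : sInf (P n x) = sInf (P n y)) : P n x = P n y := by
  obtain ⟨hx₁, hx₂⟩ := hP.eq_Ico n hx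
  obtain ⟨hy₁, hy₂⟩ := hP.eq_Ico n hy
  refine hP.eq_of_not_disjoint hx hy (Set.not_disjoint_iff.2 ⟨sInf (P n x), ?_, ?_⟩)
  · exact hx₁.symm.subset ⟨le_rfl, hx₂⟩
  · exact hy₁.symm.subset ⟨h.ge, h ▸ hy₂⟩

theorem sum_measure_atoms_le (hP : PartitionFamily P) (n : ℕ) (lam : Measure ℝ)
    [IsProbabilityMeasure lam] : ∑ J ∈ (hP.finite_atoms n).toFinset, lam J ≤ 1 := by
  have hd : Set.PairwiseDisjoint (↑(hP.finite_atoms n).toFinset : Set (Set ℝ)) id := by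
    intro J hJ K hK hne
    simp only [Set.Finite.coe_toFinset, Set.mem_ofPred_eq] at hJ hK
    obtain ⟨x, hx, rfl⟩ := hJ
    obtain ⟨y, hy, rfl⟩ := hK
    by_contra h
    exact hne (hP.eq_of_not_disjoint hx hy h)
  have hm : ∀ J ∈ (hP.finite_atoms n).toFinset, MeasurableSet (id J) := by
    intro J hJ
    simp only [Set.Finite.mem_toFinset, Set.mem_ofPred_eq] at hJ
    obtain ⟨x, hx, rfl⟩ := hJ
    exact hP.measurableSet n hx
  have := measure_biUnion_finset (μ := lam) hd hm
  simp only [id] at this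
  rw [← this]
  exact prob_le_one

theorem measureReal_succ_le (hP : PartitionFamily P) (hS : SplitsAtomsInTwo P) {C : ℝ}
    (hC : 1 < C) {lam : Measure ℝ} [IsProbabilityMeasure lam] (hL : ChildComparable P C lam)
    (n : ℕ) {x : ℝ} (hx : x ∈ Set.Ico (0 : ℝ) 1) :
    lam.real (P (n + 1) x) ≤ (1 - 1 / C) * lam.real (P n x) := by
  obtain ⟨w, hw, hwn, hne⟩ : ∃ w ∈ Set.Ico (0 : ℝ) 1, P (n + 1) w ⊆ P n x ∧
      P (n + 1) w ≠ P (n + 1) x := by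
    obtain ⟨y, hy, z, hz, hyn, hzn, hyz⟩ := hS n x hx
    by_cases h : P (n + 1) y = P (n + 1) x
    · exact ⟨z, hz, hzn, fun h' => hyz (h.trans h'.symm)⟩
    · exact ⟨y, hy, hyn, h⟩
  have hdisj : Disjoint (P (n + 1) w) (P (n + 1) x) := by
    by_contra h
    exact hne (hP.eq_of_not_disjoint hw hx h)
  have hsum : lam.real (P (n + 1) w) + lam.real (P (n + 1) x) ≤ lam.real (P n x) := by
    rw [← measureReal_union hdisj (hP.measurableSet _ hx)]
    exact measureReal_mono (Set.union_subset hwn (hP.antitone hx n.le_succ))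
  have hcmp := hL n x hx w hw hwn
  have : 1 / C * lam.real (P n x) ≤ lam.real (P (n + 1) w) := by
    rw [one_div, inv_mul_le_iff₀ (by linarith)]
    exact hcmp
  linarith

theorem measureReal_add_le (hP : PartitionFamily P) (hS : SplitsAtomsInTwo P) {C : ℝ}
    (hC : 1 < C) {lam : Measure ℝ} [IsProbabilityMeasure lam] (hL : ChildComparable P C lam)
    (n j : ℕ) {x : ℝ} (hx : x ∈ Set.Ico (0 : ℝ) 1) :
    lam.real (P (n + j) x) ≤ (1 - 1 / C) ^ j * lam.real (P n x) := by
  have hq := one_sub_one_div_pos hC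
  induction j with
  | zero => simp
  | succ j ih =>
    calc lam.real (P (n + j + 1) x) ≤ (1 - 1 / C) * lam.real (P (n + j) x) :=
          hP.measureReal_succ_le hS hC hL _ hx
      _ ≤ (1 - 1 / C) * ((1 - 1 / C) ^ j * lam.real (P n x)) := by gcongr
      _ = _ := by ring

theorem measure_le_pow (hP : PartitionFamily P) (hS : SplitsAtomsInTwo P) {C : ℝ}
    (hC : 1 < C) {lam : Measure ℝ} [IsProbabilityMeasure lam] (hL : ChildComparable P C lam)
    (n : ℕ) {x : ℝ} (hx : x ∈ Set.Ico (0 : ℝ) 1) :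
    lam (P n x) ≤ ENNReal.ofReal ((1 - 1 / C) ^ n) := by
  have hq := one_sub_one_div_pos hC
  have h := hP.measureReal_add_le hS hC hL 0 n hx
  rw [zero_add] at h
  rw [ENNReal.le_ofReal_iff_toReal_le (measure_ne_top _ _) (by positivity)]
  refine h.trans (mul_le_of_le_one_right (by positivity) measureReal_le_one)

theorem tendsto_ofReal_pow {C : ℝ} (hC : 1 < C) :
    Tendsto (fun n : ℕ => ENNReal.ofReal ((1 - 1 / C) ^ n)) atTop (nhds 0) := by
  have hq := one_sub_one_div_pos hC
  have h1 : 0 < 1 / C := by positivity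
  have := ENNReal.tendsto_ofReal (tendsto_pow_atTop_nhds_zero_of_lt_one hq.le (by linarith))
  rwa [ENNReal.ofReal_zero] at this

theorem measure_singleton (hP : PartitionFamily P) (hS : SplitsAtomsInTwo P) {C : ℝ}
    (hC : 1 < C) {lam : Measure ℝ} [IsProbabilityMeasure lam] (hL : ChildComparable P C lam)
    {x : ℝ} (hx : x ∈ Set.Ico (0 : ℝ) 1) : lam {x} = 0 := by
  refine le_antisymm (ge_of_tendsto' (tendsto_ofReal_pow hC) fun n => ?_) zero_le
  exact (measure_mono (Set.singleton_subset_iff.2 (hP.mem_self n hx))).trans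
    (hP.measure_le_pow hS hC hL n hx)

/-- Almost every point is interior to all the atoms containing it. -/
theorem ae_ne_sInf (hP : PartitionFamily P) (hS : SplitsAtomsInTwo P) {C : ℝ}
    (hC : 1 < C) {lam : Measure ℝ} [IsProbabilityMeasure lam] (hL : ChildComparable P C lam) :
    ∀ᵐ x ∂lam, x ∈ Set.Ico (0 : ℝ) 1 → ∀ n, x ≠ sInf (P n x) := by
  set S : Set ℝ := Set.Ico (0 : ℝ) 1 ∩ ⋃ n, sInf '' {J : Set ℝ | AtomOf P n J}
  have hcount : S.Countable :=
    (Set.countable_iUnion fun n => ((hP.finite_atoms n).image _).countable).mono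
      Set.inter_subset_right
  have hnull : lam S = 0 := by
    rw [← Set.biUnion_of_singleton S]
    exact (measure_biUnion_null_iff hcount).2 fun x hx => hP.measure_singleton hS hC hL hx.1
  filter_upwards [measure_eq_zero_iff_ae_notMem.1 hnull] with x hxS hx n hxn
  exact hxS ⟨hx, Set.mem_iUnion.2 ⟨n, P n x, ⟨x, hx, rfl⟩, hxn.symm⟩⟩

/-- Points whose atom shares an endpoint, or any other invariant `e` separating the atoms of one
generation, with its `j`-th descendant are rare. -/
theorem measure_endpoint_eq_le (hP : PartitionFamily P) (hS : SplitsAtomsInTwo P) {C : ℝ}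
    (hC : 1 < C) {lam : Measure ℝ} [IsProbabilityMeasure lam] (hL : ChildComparable P C lam)
    (e : Set ℝ → ℝ)
    (he : ∀ n, ∀ x ∈ Set.Ico (0 : ℝ) 1, ∀ y ∈ Set.Ico (0 : ℝ) 1,
      e (P n x) = e (P n y) → P n x = P n y) (k j : ℕ) :
    lam {x | x ∈ Set.Ico (0 : ℝ) 1 ∧ e (P (k + j) x) = e (P k x)} ≤
      ENNReal.ofReal ((1 - 1 / C) ^ j) := by
  have hq := one_sub_one_div_pos hC
  set A := {x | x ∈ Set.Ico (0 : ℝ) 1 ∧ e (P (k + j) x) = e (P k x)} with hA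
  set F := (hP.finite_atoms k).toFinset with hF
  have hcov : A ⊆ ⋃ J ∈ F, A ∩ J := by
    intro x hx
    refine Set.mem_biUnion (x := P k x) ?_ ⟨hx, hP.mem_self k hx.1⟩
    simp only [hF, Set.Finite.coe_toFinset]
    exact ⟨x, hx.1, rfl⟩
  calc lam A ≤ ∑ J ∈ F, lam (A ∩ J) := (measure_mono hcov).trans (measure_biUnion_finset_le _ _)
    _ ≤ ∑ J ∈ F, ENNReal.ofReal ((1 - 1 / C) ^ j) * lam J := by
      refine Finset.sum_le_sum fun J hJ => ?_
      rw [hF, Set.Finite.mem_toFinset] at hJ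
      obtain ⟨w, hw, rfl⟩ := hJ
      rcases (A ∩ P k w).eq_empty_or_nonempty with h | ⟨y, hyA, hyw⟩
      · simp [h]
      have hyk : P k y = P k w := hP.eq_of_mem hw hyw
      have hsub : A ∩ P k w ⊆ P (k + j) y := by
        rintro z ⟨hzA, hzw⟩
        have hzk : P k z = P k w := hP.eq_of_mem hw hzw
        have : P (k + j) z = P (k + j) y := by
          refine he _ z hzA.1 y hyA.1 ?_
          rw [hzA.2, hyA.2, hzk, hyk]
        rw [← this]
        exact hP.mem_self _ hzA.1
      refine (measure_mono hsub).trans ?_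
      have h := hP.measureReal_add_le hS hC hL k j hyA.1
      rw [← hyk, ← ofReal_measureReal (μ := lam) (s := P (k + j) y),
        ← ofReal_measureReal (μ := lam) (s := P k y), ← ENNReal.ofReal_mul (by positivity)]
      exact ENNReal.ofReal_le_ofReal h
    _ = ENNReal.ofReal ((1 - 1 / C) ^ j) * ∑ J ∈ F, lam J := by rw [Finset.mul_sum]
    _ ≤ ENNReal.ofReal ((1 - 1 / C) ^ j) := mul_le_of_le_one_right' (hP.sum_measure_atoms_le k lam)

end PartitionFamily

theorem summable_pow_sqrt {q : ℝ} (hq0 : 0 < q) (hq1 : q < 1) :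
    Summable fun n : ℕ => q ^ Nat.sqrt n := by
  have hlim := tendsto_pow_const_mul_const_pow_of_abs_lt_one 4 (r := q)
    (by rwa [abs_of_pos hq0])
  obtain ⟨M, hM⟩ := hlim.bddAbove_range
  have hMb : ∀ n : ℕ, (n : ℝ) ^ 4 * q ^ n ≤ M := fun n => hM ⟨n, rfl⟩
  have hsum : Summable fun n : ℕ => (M / q) * (1 / (n : ℝ) ^ 2) :=
    (Real.summable_one_div_nat_pow.2 one_lt_two).mul_left _
  refine (summable_nat_add_iff 1).1 (Summable.of_nonneg_of_le (fun n => by positivity) (fun n => ?_)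
    ((summable_nat_add_iff 1).2 hsum))
  set k := n + 1 with hk
  have hkpos : (0 : ℝ) < k := by positivity
  have h := hMb (Nat.sqrt k + 1)
  have hlt : (k : ℝ) ≤ ((Nat.sqrt k + 1 : ℕ) : ℝ) ^ 2 := by
    exact_mod_cast (Nat.lt_succ_sqrt' k).le
  have h4 : (k : ℝ) ^ 2 * q ^ (Nat.sqrt k + 1) ≤ M := by
    refine le_trans ?_ h
    gcongr
    calc (k : ℝ) ^ 2 ≤ (((Nat.sqrt k + 1 : ℕ) : ℝ) ^ 2) ^ 2 := by gcongr
      _ = _ := by ring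
  rw [mul_one_div, le_div_iff₀ (by positivity), le_div_iff₀ hq0]
  calc q ^ Nat.sqrt k * (k : ℝ) ^ 2 * q = (k : ℝ) ^ 2 * q ^ (Nat.sqrt k + 1) := by ring
    _ ≤ M := h4

theorem PartitionFamily.ae_eventually_endpoint_ne {P : ℕ → ℝ → Set ℝ} (hP : PartitionFamily P)
    (hS : SplitsAtomsInTwo P) {C : ℝ}
    (hC : 1 < C) {lam : Measure ℝ} [IsProbabilityMeasure lam] (hL : ChildComparable P C lam)
    (e : Set ℝ → ℝ)
    (he : ∀ n, ∀ x ∈ Set.Ico (0 : ℝ) 1, ∀ y ∈ Set.Ico (0 : ℝ) 1,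
      e (P n x) = e (P n y) → P n x = P n y) :
    ∀ᵐ x ∂lam, x ∈ Set.Ico (0 : ℝ) 1 →
      ∀ᶠ k : ℕ in atTop, e (P (k + Nat.sqrt k) x) ≠ e (P k x) := by
  have hq := one_sub_one_div_pos hC
  have h1 : 0 < 1 / C := by positivity
  have hne : ∑' k : ℕ, lam {x | x ∈ Set.Ico (0 : ℝ) 1 ∧ e (P (k + Nat.sqrt k) x) = e (P k x)} ≠
      ∞ := by
    refine ne_top_of_le_ne_top
      (summable_pow_sqrt hq (by linarith)).tsum_ofReal_ne_top ?_
    exact ENNReal.tsum_le_tsum fun k => hP.measure_endpoint_eq_le hS hC hL e he k _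
  filter_upwards [ae_eventually_notMem hne] with x hx hxI
  filter_upwards [hx] with k hk h
  exact hk ⟨hxI, h⟩

/-- Interpolating a linearly growing sequence along `n + 1 + √(n + 1)`. -/
theorem tendsto_div_comp_add_sqrt {f : ℕ → ℝ} {a : ℝ}
    (hf : Tendsto (fun n : ℕ => f n / n) atTop (nhds a)) (c : ℝ) :
    Tendsto (fun n : ℕ => (c + f (n + 1 + Nat.sqrt (n + 1))) / n) atTop (nhds a) := by
  have hinv : Tendsto (fun n : ℕ => 1 / (n : ℝ)) atTop (nhds 0) :=
    tendsto_one_div_atTop_nhds_zero_nat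
  have hsq : Tendsto (fun n : ℕ => 1 / √(n : ℝ)) atTop (nhds 0) := by
    simp only [one_div]
    exact tendsto_inv_atTop_zero.comp (Real.tendsto_sqrt_atTop.comp tendsto_natCast_atTop_atTop)
  have hs : Tendsto (fun n : ℕ => (Nat.sqrt (n + 1) : ℝ) / n) atTop (nhds 0) := by
    refine squeeze_zero (g := fun n : ℕ => 1 / √(n : ℝ) + 1 / (n : ℝ)) (fun n => by positivity)
      (fun n => ?_) (by simpa using hsq.add hinv)
    rw [← Real.sqrt_div_self', ← add_div]
    gcongr
    refine Real.nat_sqrt_le_real_sqrt.trans ?_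
    push_cast
    refine Real.sqrt_le_iff.2 ⟨by positivity, ?_⟩
    nlinarith [Real.sq_sqrt (Nat.cast_nonneg (α := ℝ) n), Real.sqrt_nonneg (n : ℝ)]
  have hh : Tendsto (fun n : ℕ => n + 1 + Nat.sqrt (n + 1)) atTop atTop :=
    tendsto_atTop_mono (fun n => (by omega : n ≤ n + 1 + Nat.sqrt (n + 1))) tendsto_id
  have hratio : Tendsto (fun n : ℕ => ((n + 1 + Nat.sqrt (n + 1) : ℕ) : ℝ) / n) atTop (nhds 1) := by
    have : Tendsto (fun n : ℕ => 1 + 1 / (n : ℝ) + (Nat.sqrt (n + 1) : ℝ) / n) atTop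
        (nhds (1 + 0 + 0)) := (tendsto_const_nhds.add hinv).add hs
    rw [add_zero, add_zero] at this
    refine this.congr' ?_
    filter_upwards [eventually_gt_atTop 0] with n hn
    have : (n : ℝ) ≠ 0 := by positivity
    push_cast
    field_simp
  have := (hinv.const_mul c).add ((hf.comp hh).mul hratio)
  rw [mul_zero, zero_add, mul_one] at this
  refine this.congr' ?_
  filter_upwards [eventually_gt_atTop 0] with n hn
  have h1 : (n : ℝ) ≠ 0 := by positivity
  have h2 : ((n + 1 + Nat.sqrt (n + 1) : ℕ) : ℝ) ≠ 0 := by positivity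
  simp only [Function.comp]
  field_simp

/-- A function `u` on `ℕ` that differs at `k + j` from its value at `k` leaves that value at some
intermediate step. -/
theorem exists_step_ne {u : ℕ → ℝ} {k j : ℕ} (h : u (k + j) ≠ u k) :
    ∃ i, k ≤ i ∧ i < k + j ∧ u i = u k ∧ u (i + 1) ≠ u k := by
  by_contra! hcon
  have : ∀ i ≤ j, u (k + i) = u k := by
    intro i
    induction i with
    | zero => simp
    | succ i ih =>
      intro hi
      exact hcon (k + i) (by omega) (by omega) (ih (by omega))
  exact h (this j le_rfl)

namespace PartitionFamily

variable {P : ℕ → ℝ → Set ℝ}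

/-- A ball that leaves the atom `P k x` contains an atom which is a child of some `P i x` with `i`
not much larger than `k`, as soon as both endpoints of `P (k + j) x` and `P k x` differ. -/
theorem exists_child_subset_ball (hP : PartitionFamily P) {x : ℝ} (hx : x ∈ Set.Ico (0 : ℝ) 1)
    {k j : ℕ} {ε : ℝ} (hε : 0 < ε)
    (hsup : sSup (P (k + j) x) ≠ sSup (P k x)) (hinf : sInf (P (k + j) x) ≠ sInf (P k x))
    (hball : ¬ Set.Ioo (x - ε) (x + ε) ⊆ P k x) :
    ∃ i, i < k + j ∧ ∃ y ∈ Set.Ico (0 : ℝ) 1,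
      P (i + 1) y ⊆ P i x ∧ P (i + 1) y ⊆ Set.Ioo (x - ε) (x + ε) := by
  obtain ⟨w, ⟨hw₁, hw₂⟩, hw⟩ := Set.not_subset.1 hball
  have hIco := fun n => hP.eq_Ico n hx
  have hmem : ∀ n z, z ∈ P n x ↔ sInf (P n x) ≤ z ∧ z < sSup (P n x) := fun n z => by
    constructor
    · exact fun hz => (hIco n).1.subset hz
    · exact fun hz => (hIco n).1.symm.subset hz
  have hxm := fun n => (hmem n x).1 (hP.mem_self n hx)
  have hconv : ∀ n, ∀ y ∈ Set.Ico (0 : ℝ) 1, ∀ s ∈ P n y, ∀ t ∈ P n y, Set.Icc s t ⊆ P n y := by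
    intro n y hy s hs t ht
    obtain ⟨l, r, -, h, -⟩ := hP.2.1 n y hy
    rw [h] at hs ht ⊢
    exact fun u hu => ⟨hs.1.trans hu.1, hu.2.trans_lt ht.2⟩
  have key : ∀ i, ∀ y ∈ P i x, y ∉ P (i + 1) x → y ∈ Set.Ico (0 : ℝ) 1 ∧
      P (i + 1) y ⊆ P i x ∧ y ∈ P (i + 1) y ∧ Disjoint (P (i + 1) y) (P (i + 1) x) := by
    intro i y hy hy'
    have hyI := hP.subset_Ico i hx hy
    refine ⟨hyI, ?_, hP.mem_self _ hyI, ?_⟩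
    · rw [← hP.eq_of_mem hx hy]
      exact hP.antitone hyI i.le_succ
    · by_contra h
      exact hy' (hP.eq_of_not_disjoint hyI hx h ▸ hP.mem_self (i + 1) hyI)
  rw [hmem, not_and_or, not_le, not_lt] at hw
  rcases hw with hw | hw
  · obtain ⟨i, -, hij, hi, hi'⟩ := exists_step_ne (u := fun n => sInf (P n x)) hinf
    have hlt : sInf (P i x) < sInf (P (i + 1) x) := by
      have h := ((hmem i _).1 (hP.antitone hx i.le_succ ((hmem (i + 1) _).2
        ⟨le_rfl, (hIco (i + 1)).2⟩))).1
      exact lt_of_le_of_ne h (by rw [hi]; exact hi'.symm)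
    obtain ⟨hyI, hsub, hyy, hdisj⟩ := key i (sInf (P i x)) ((hmem i _).2 ⟨le_rfl, (hIco i).2⟩)
      (fun h => not_le.2 hlt ((hmem _ _).1 h).1)
    refine ⟨i, hij, _, hyI, hsub, fun z hz => ⟨?_, ?_⟩⟩
    · have := ((hmem i z).1 (hsub hz)).1
      linarith
    · have hzlt : z < x := by
        by_contra! hle
        exact Set.disjoint_left.1 hdisj
          (hconv _ _ hyI _ hyy _ hz ⟨(hxm i).1, hle⟩) (hP.mem_self _ hx)
      linarith
  · obtain ⟨i, -, hij, hi, hi'⟩ := exists_step_ne (u := fun n => sSup (P n x)) hsup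
    have hle : sSup (P (i + 1) x) ≤ sSup (P i x) := by
      have hne : (P (i + 1) x).Nonempty := ⟨x, hP.mem_self _ hx⟩
      refine csSup_le hne fun z hz => ((hmem i z).1 (hP.antitone hx i.le_succ hz)).2.le
    have hlt : sSup (P (i + 1) x) < sSup (P i x) := lt_of_le_of_ne hle (by rw [hi]; exact hi')
    obtain ⟨hyI, hsub, hyy, hdisj⟩ := key i (sSup (P (i + 1) x))
      ((hmem i _).2 ⟨(hxm i).1.trans (hxm (i + 1)).2.le, hlt⟩)
      (fun h => lt_irrefl _ ((hmem _ _).1 h).2)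
    refine ⟨i, hij, _, hyI, hsub, fun z hz => ⟨?_, ?_⟩⟩
    · have hzlt : x < z := by
        by_contra! hle
        exact Set.disjoint_left.1 hdisj
          (hconv _ _ hyI _ hz _ hyy ⟨hle, (hxm (i + 1)).2.le⟩) (hP.mem_self _ hx)
      linarith
    · have := ((hmem i z).1 (hsub hz)).2
      linarith

theorem eventually_ball_subset (hP : PartitionFamily P) {x : ℝ} (hx : x ∈ Set.Ico (0 : ℝ) 1)
    {n : ℕ} (hint : x ≠ sInf (P n x)) :
    ∀ᶠ ε in nhdsWithin (0 : ℝ) (Set.Ioi 0), Set.Ioo (x - ε) (x + ε) ⊆ P n x := by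
  obtain ⟨h, -⟩ := hP.eq_Ico n hx
  have hxm := h.subset (hP.mem_self n hx)
  have hl : 0 < x - sInf (P n x) := sub_pos.2 (lt_of_le_of_ne hxm.1 hint.symm)
  have hr : 0 < sSup (P n x) - x := sub_pos.2 hxm.2
  filter_upwards [Ioo_mem_nhdsGT (lt_min hl hr)] with ε hε
  have h1 := hε.2.trans_le (min_le_left _ _)
  have h2 := hε.2.trans_le (min_le_right _ _)
  refine fun z hz => h.symm.subset ⟨?_, ?_⟩
  · linarith [hz.1]
  · linarith [hz.2]

/-- For a small ball around an interior point there is a last atom containing it. -/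
theorem exists_level (hP : PartitionFamily P) {x : ℝ} (hx : x ∈ Set.Ico (0 : ℝ) 1)
    (hint : ∀ n, x ≠ sInf (P n x)) (hsingle : (⋂ n : ℕ, P (n + 1) x) = {x}) :
    ∃ κ : ℝ → ℕ, Tendsto κ (nhdsWithin 0 (Set.Ioi 0)) atTop ∧
      ∀ᶠ ε in nhdsWithin (0 : ℝ) (Set.Ioi 0), Set.Ioo (x - ε) (x + ε) ⊆ P (κ ε) x ∧
        ¬ Set.Ioo (x - ε) (x + ε) ⊆ P (κ ε + 1) x := by
  have hex : ∀ ε : ℝ, ∃ k : ℕ, 0 < ε → Set.Ioo (x - ε) (x + ε) ⊆ P 0 x →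
      Set.Ioo (x - ε) (x + ε) ⊆ P k x ∧ ¬ Set.Ioo (x - ε) (x + ε) ⊆ P (k + 1) x := by
    intro ε
    by_contra! hcon
    have hε := (hcon 0).1
    have hall : ∀ n, Set.Ioo (x - ε) (x + ε) ⊆ P n x := by
      intro n
      induction n with
      | zero => exact (hcon 0).2.1
      | succ n ih => exact (hcon n).2.2 ih
    have hmem : x + ε / 2 ∈ ⋂ n : ℕ, P (n + 1) x :=
      Set.mem_iInter.2 fun n => hall (n + 1) ⟨by linarith, by linarith⟩
    rw [hsingle, Set.mem_singleton_iff] at hmem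
    linarith
  choose κ hκ using hex
  have hev : ∀ᶠ ε in nhdsWithin (0 : ℝ) (Set.Ioi 0), Set.Ioo (x - ε) (x + ε) ⊆ P (κ ε) x ∧
        ¬ Set.Ioo (x - ε) (x + ε) ⊆ P (κ ε + 1) x := by
    filter_upwards [self_mem_nhdsWithin, hP.eventually_ball_subset hx (hint 0)] with ε h1 h2
    exact hκ ε h1 h2
  refine ⟨κ, tendsto_atTop.2 fun M => ?_, hev⟩
  filter_upwards [hev, hP.eventually_ball_subset hx (hint M)] with ε h1 h2
  by_contra! hlt
  exact h1.2 (h2.trans (hP.antitone hx hlt))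

theorem tendsto_neg_log_ball_div (hP : PartitionFamily P) {x : ℝ} (hx : x ∈ Set.Ico (0 : ℝ) 1)
    {C : ℝ} (hC : 1 < C) {lam : Measure ℝ} [IsProbabilityMeasure lam]
    (hL : ChildComparable P C lam)
    (hsup : ∀ᶠ k : ℕ in atTop, sSup (P (k + Nat.sqrt k) x) ≠ sSup (P k x))
    (hinf : ∀ᶠ k : ℕ in atTop, sInf (P (k + Nat.sqrt k) x) ≠ sInf (P k x))
    {κ : ℝ → ℕ} (hκ : Tendsto κ (nhdsWithin 0 (Set.Ioi 0)) atTop)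
    (hκ' : ∀ᶠ ε in nhdsWithin (0 : ℝ) (Set.Ioi 0), Set.Ioo (x - ε) (x + ε) ⊆ P (κ ε) x ∧
        ¬ Set.Ioo (x - ε) (x + ε) ⊆ P (κ ε + 1) x)
    (hpos : ∀ n, 0 < lam.real (P n x)) {a : ℝ}
    (hlim : Tendsto (fun n : ℕ => -Real.log (lam.real (P n x)) / n) atTop (nhds a)) :
    Tendsto (fun ε : ℝ => -Real.log (lam.real (Set.Ioo (x - ε) (x + ε))) / κ ε)
      (nhdsWithin 0 (Set.Ioi 0)) (nhds a) := by
  have hκ1 : Tendsto (fun ε => κ ε + 1) (nhdsWithin 0 (Set.Ioi 0)) atTop :=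
    tendsto_atTop_mono (fun ε => Nat.le_succ _) hκ
  have hbound : ∀ᶠ ε in nhdsWithin (0 : ℝ) (Set.Ioi 0),
      lam.real (P (κ ε + 1 + Nat.sqrt (κ ε + 1)) x) ≤
        C * lam.real (Set.Ioo (x - ε) (x + ε)) := by
    filter_upwards [hκ', hκ1.eventually hsup, hκ1.eventually hinf, self_mem_nhdsWithin]
      with ε h1 h2 h3 hε
    obtain ⟨i, hi, y, hy, hyi, hyb⟩ := hP.exists_child_subset_ball hx hε h2 h3 h1.2
    calc lam.real (P (κ ε + 1 + Nat.sqrt (κ ε + 1)) x) ≤ lam.real (P i x) :=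
          measureReal_mono (hP.antitone hx hi.le)
      _ ≤ C * lam.real (P (i + 1) y) := hL i x hx y hy hyi
      _ ≤ _ := by
        gcongr
        finiteness
  refine tendsto_of_tendsto_of_tendsto_of_le_of_le' (hlim.comp hκ)
    ((tendsto_div_comp_add_sqrt hlim (Real.log C)).comp hκ) ?_ ?_
  · filter_upwards [hκ', hbound] with ε h1 h2
    have hB : 0 < lam.real (Set.Ioo (x - ε) (x + ε)) :=
      pos_of_mul_pos_right ((hpos _).trans_le h2) (by linarith)
    simp only [Function.comp]
    gcongr
    · finiteness
    · exact h1.1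
  · filter_upwards [hbound] with ε h2
    have hB : 0 < lam.real (Set.Ioo (x - ε) (x + ε)) :=
      pos_of_mul_pos_right ((hpos _).trans_le h2) (by linarith)
    simp only [Function.comp]
    gcongr
    have := Real.log_le_log (hpos _) h2
    rw [Real.log_mul (by linarith) hB.ne'] at this
    linarith

theorem limit_eq_zero_of_measureReal_eq_zero (hP : PartitionFamily P) {x : ℝ} (hx : x ∈ Set.Ico (0 : ℝ) 1)
    {lam : Measure ℝ} [IsFiniteMeasure lam] {N : ℕ} (h0 : lam.real (P N x) = 0) {a : ℝ}
    (hlim : Tendsto (fun n : ℕ => -Real.log (lam.real (P n x)) / n) atTop (nhds a)) : a = 0 := by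
  refine tendsto_nhds_unique hlim (tendsto_const_nhds.congr' ?_)
  filter_upwards [eventually_ge_atTop N] with n hn
  have : lam.real (P n x) = 0 :=
    le_antisymm (h0 ▸ measureReal_mono (hP.antitone hx hn)) measureReal_nonneg
  simp [this]

theorem tendsto_log_ball_div_log_ball (hP : PartitionFamily P) (hS : SplitsAtomsInTwo P) {C : ℝ}
    (hC : 1 < C) {μ ν m : Measure ℝ} [IsProbabilityMeasure μ] [IsProbabilityMeasure ν]
    [IsProbabilityMeasure m] (hμ : ChildComparable P C μ) (hν : ChildComparable P C ν)
    (hm : ChildComparable P C m) {a b : ℝ} (hb : 0 < b)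
    (hA : ∀ᵐ x ∂m, x ∈ Set.Ico (0 : ℝ) 1 →
      Tendsto (fun n : ℕ => -(Real.log ((μ (P n x)).toReal)) / n) atTop (nhds a))
    (hB : ∀ᵐ x ∂m, x ∈ Set.Ico (0 : ℝ) 1 →
      Tendsto (fun n : ℕ => -(Real.log ((ν (P n x)).toReal)) / n) atTop (nhds b))
    (hd : ∀ᵐ x ∂m, x ∈ Set.Ico (0 : ℝ) 1 → (⋂ n : ℕ, P (n + 1) x) = {x}) :
    ∀ᵐ x ∂m, x ∈ Set.Ico (0 : ℝ) 1 →
      Tendsto (fun ε : ℝ =>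
          Real.log ((μ (Set.Ioo (x - ε) (x + ε))).toReal) /
            Real.log ((ν (Set.Ioo (x - ε) (x + ε))).toReal))
        (nhdsWithin 0 (Set.Ioi 0)) (nhds (a / b)) := by
  filter_upwards [hA, hB, hd, hP.ae_ne_sInf hS hC hm,
    hP.ae_eventually_endpoint_ne hS hC hm sSup (fun n x hx y hy => hP.eq_of_sSup_eq hx hy),
    hP.ae_eventually_endpoint_ne hS hC hm sInf (fun n x hx y hy => hP.eq_of_sInf_eq hx hy)]
    with x hAx hBx hdx hint hsup hinf hx
  replace hAx := hAx hx
  replace hBx := hBx hx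
  have hνpos : ∀ n, 0 < ν.real (P n x) := fun n =>
    lt_of_le_of_ne measureReal_nonneg fun h =>
      hb.ne' (hP.limit_eq_zero_of_measureReal_eq_zero hx h.symm hBx)
  by_cases hμpos : ∀ n, 0 < μ.real (P n x)
  · obtain ⟨κ, hκ, hκ'⟩ := hP.exists_level hx (hint hx) (hdx hx)
    have h1 := hP.tendsto_neg_log_ball_div hx hC hμ (hsup hx) (hinf hx) hκ hκ' hμpos hAx
    have h2 := hP.tendsto_neg_log_ball_div hx hC hν (hsup hx) (hinf hx) hκ hκ' hνpos hBx
    refine (h1.div h2 hb.ne').congr' ?_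
    filter_upwards [hκ.eventually_gt_atTop 0] with ε hε
    have : (κ ε : ℝ) ≠ 0 := by positivity
    simp only [Pi.div_apply]
    rw [div_div_div_cancel_right₀ this, neg_div_neg_eq]
    rfl
  · push Not at hμpos
    obtain ⟨N, hN⟩ := hμpos
    have hN0 : μ.real (P N x) = 0 := le_antisymm hN measureReal_nonneg
    rw [hP.limit_eq_zero_of_measureReal_eq_zero hx hN0 hAx, zero_div]
    refine tendsto_const_nhds.congr' ?_
    filter_upwards [hP.eventually_ball_subset hx (hint hx N)] with ε hε
    have : μ.real (Set.Ioo (x - ε) (x + ε)) = 0 :=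
      le_antisymm (hN0 ▸ measureReal_mono hε) measureReal_nonneg
    rw [measureReal_def] at this
    simp [this]

end PartitionFamily

/-- The mass distribution principle. -/
theorem le_dimH_of_ae_measure_ball_le {μ : Measure ℝ} {r : ℝ≥0}
    (h : ∀ᵐ x ∂μ, ∀ᶠ ε in nhdsWithin (0 : ℝ) (Set.Ioi 0),
      μ (Set.Ioo (x - ε) (x + ε)) ≤ ENNReal.ofReal (2 * ε) ^ (r : ℝ))
    {E : Set ℝ} (hE : μ E ≠ 0) : (r : ℝ≥0∞) ≤ dimH E := by
  set F : ℕ → Set ℝ := fun n => {x | x ∈ E ∧ ∀ ε ∈ Set.Ioo (0 : ℝ) (1 / (n + 1)),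
    μ (Set.Ioo (x - ε) (x + ε)) ≤ ENNReal.ofReal (2 * ε) ^ (r : ℝ)}
  obtain ⟨n, hn⟩ : ∃ n, μ (F n) ≠ 0 := by
    by_contra! hcon
    refine hE (measure_mono_null (t := (⋃ n, F n) ∪ {x | ¬ ∀ᶠ ε in nhdsWithin (0 : ℝ) (Set.Ioi 0),
      μ (Set.Ioo (x - ε) (x + ε)) ≤ ENNReal.ofReal (2 * ε) ^ (r : ℝ)}) (fun x hx => ?_)
      (measure_union_null (measure_iUnion_null hcon) (ae_iff.1 h)))
    by_cases hx' : ∀ᶠ ε in nhdsWithin (0 : ℝ) (Set.Ioi 0),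
      μ (Set.Ioo (x - ε) (x + ε)) ≤ ENNReal.ofReal (2 * ε) ^ (r : ℝ)
    · obtain ⟨u, hu, hsub⟩ := mem_nhdsGT_iff_exists_Ioo_subset.1 hx'
      obtain ⟨n, hn⟩ := exists_nat_one_div_lt (Set.mem_Ioi.1 hu)
      exact Or.inl (Set.mem_iUnion.2 ⟨n, hx, fun ε hε => hsub ⟨hε.1, hε.2.trans hn⟩⟩)
    · exact Or.inr hx'
  have hFE : F n ⊆ E := fun x hx => hx.1
  refine le_trans (le_dimH_of_hausdorffMeasure_ne_zero fun h0 => hn ?_) (dimH_mono hFE)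
  have hc0 : (2 : ℝ≥0∞) ^ (r : ℝ) ≠ 0 := by simp [ENNReal.rpow_eq_zero_iff]
  have hct : (2 : ℝ≥0∞) ^ (r : ℝ) ≠ ∞ := by
    refine ENNReal.rpow_ne_top_of_nonneg r.coe_nonneg (by simp)
  have hle : OuterMeasure.restrict (F n) μ.toOuterMeasure ≤
      OuterMeasure.mkMetric fun d : ℝ≥0∞ => (2 : ℝ≥0∞) ^ (r : ℝ) * d ^ (r : ℝ) := by
    refine OuterMeasure.le_mkMetric _ _ (ENNReal.ofReal (1 / (n + 2)))
      (ENNReal.ofReal_pos.2 (by positivity)) fun U hU => ?_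
    rw [OuterMeasure.restrict_apply]
    rcases (U ∩ F n).eq_empty_or_nonempty with he | ⟨x, hxU, hxF⟩
    · simp [he]
    have hUtop : Metric.ediam U ≠ ∞ := ne_top_of_le_ne_top ENNReal.ofReal_ne_top hU
    set d := (Metric.ediam U).toReal with hd
    have hdU : Metric.ediam U = ENNReal.ofReal d := (ENNReal.ofReal_toReal hUtop).symm
    have hd0 : 0 ≤ d := ENNReal.toReal_nonneg
    have hdlt : d < 1 / ((n : ℝ) + 1) := by
      refine lt_of_le_of_lt (ENNReal.toReal_le_of_le_ofReal (by positivity) hU) ?_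
      gcongr
      norm_num
    have hδ : ∀ δ ∈ Set.Ioo d (1 / ((n : ℝ) + 1)),
        μ (U ∩ F n) ≤ ENNReal.ofReal (2 * δ) ^ (r : ℝ) := by
      intro δ hδ
      refine (measure_mono fun z hz => ?_).trans (hxF.2 δ ⟨hd0.trans_lt hδ.1, hδ.2⟩)
      have : edist z x ≤ ENNReal.ofReal d := hdU ▸ Metric.edist_le_ediam_of_mem hz.1 hxU
      rw [edist_dist, ENNReal.ofReal_le_ofReal_iff hd0, Real.dist_eq, abs_le] at this
      exact ⟨by linarith [hδ.1], by linarith [hδ.1]⟩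
    have hcont : Tendsto (fun δ : ℝ => ENNReal.ofReal (2 * δ) ^ (r : ℝ))
        (nhdsWithin d (Set.Ioi d)) (nhds (ENNReal.ofReal (2 * d) ^ (r : ℝ))) := by
      have : Continuous fun δ : ℝ => ENNReal.ofReal (2 * δ) ^ (r : ℝ) :=
        ENNReal.continuous_rpow_const.comp
          (ENNReal.continuous_ofReal.comp (continuous_const.mul continuous_id))
      exact this.continuousAt.mono_left nhdsWithin_le_nhds
    have := ge_of_tendsto hcont (b := μ (U ∩ F n))
      (by filter_upwards [Ioo_mem_nhdsGT hdlt] with δ h using hδ δ h)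
    rwa [ENNReal.ofReal_mul zero_le_two, ENNReal.mul_rpow_of_nonneg _ _ r.coe_nonneg, ← hdU,
      ENNReal.ofReal_ofNat] at this
  have hsmul := OuterMeasure.mkMetric_smul (X := ℝ) (fun d : ℝ≥0∞ => d ^ (r : ℝ)) hct hc0
  have h2 := hle (F n)
  rw [OuterMeasure.restrict_apply, Set.inter_self] at h2
  have h3 : (OuterMeasure.mkMetric fun d : ℝ≥0∞ => (2 : ℝ≥0∞) ^ (r : ℝ) * d ^ (r : ℝ)) (F n) =
      (2 : ℝ≥0∞) ^ (r : ℝ) * OuterMeasure.mkMetric (fun d : ℝ≥0∞ => d ^ (r : ℝ)) (F n) := by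
    have := congrArg (fun o : OuterMeasure ℝ => o (F n)) hsmul
    exact this
  rw [h3, OuterMeasure.coe_mkMetric] at h2
  have h4 : Measure.mkMetric (fun d : ℝ≥0∞ => d ^ (r : ℝ)) (F n) = 0 := h0
  rw [h4, mul_zero] at h2
  exact le_antisymm h2 zero_le

namespace PartitionFamily

variable {P : ℕ → ℝ → Set ℝ}

theorem dimH_le_of_volume_rpow_le (hP : PartitionFamily P) {μ : Measure ℝ}
    [IsProbabilityMeasure μ] {ρ : ℕ → ℝ≥0∞} (hρ : Tendsto ρ atTop (nhds 0))
    (hvol : ∀ n, ∀ x ∈ Set.Ico (0 : ℝ) 1, volume (P n x) ≤ ρ n) {t : ℝ≥0} (ht : 0 < t) (k : ℕ) :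
    dimH {x | x ∈ Set.Ico (0 : ℝ) 1 ∧ ∀ n ≥ k, volume (P n x) ^ (t : ℝ) ≤ μ (P n x)} ≤ t := by
  set S := {x | x ∈ Set.Ico (0 : ℝ) 1 ∧ ∀ n ≥ k, volume (P n x) ^ (t : ℝ) ≤ μ (P n x)} with hS
  have hdiam : ∀ n, ∀ x ∈ Set.Ico (0 : ℝ) 1, Metric.ediam (P n x) = volume (P n x) := by
    intro n x hx
    obtain ⟨l, r, -, h, -⟩ := hP.2.1 n x hx
    rw [h, Real.ediam_Ico, Real.volume_Ico]
  refine dimH_le_of_hausdorffMeasure_ne_top (ne_top_of_le_ne_top ENNReal.one_ne_top ?_)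
  refine (Measure.hausdorffMeasure_le_liminf_sum (ι := fun n => (hP.finite_atoms n).toFinset)
    (t : ℝ) S ρ hρ (fun n J => J.1 ∩ S) (Eventually.of_forall fun n J => ?_)
    (Eventually.of_forall fun n x hx => ?_)).trans ?_
  · obtain ⟨x, hx, hJ⟩ := (hP.finite_atoms n).mem_toFinset.1 J.2
    rw [hJ]
    exact (Metric.ediam_mono Set.inter_subset_left).trans ((hdiam n x hx).trans_le (hvol n x hx))
  · exact Set.mem_iUnion.2 ⟨⟨P n x, (hP.finite_atoms n).mem_toFinset.2 ⟨x, hx.1, rfl⟩⟩,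
      hP.mem_self n hx.1, hx⟩
  · refine liminf_le_of_frequently_le' (Eventually.frequently ?_)
    filter_upwards [eventually_ge_atTop k] with n hn
    refine le_trans ?_ (hP.sum_measure_atoms_le n μ)
    rw [← Finset.sum_coe_sort (hP.finite_atoms n).toFinset (fun J => μ J)]
    refine Finset.sum_le_sum fun J _ => ?_
    obtain ⟨x, hx, hJ⟩ := (hP.finite_atoms n).mem_toFinset.1 J.2
    rcases (J.1 ∩ S).eq_empty_or_nonempty with he | ⟨y, hyJ, hyS⟩
    · simp [he, ht]
    · have hyx : P n y = J.1 := by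
        rw [hJ] at hyJ ⊢
        exact hP.eq_of_mem hx hyJ
      rw [← hyx]
      refine le_trans ?_ (hyS.2 n hn)
      gcongr
      exact (Metric.ediam_mono Set.inter_subset_left).trans (hdiam n y hyS.1).le

end PartitionFamily

theorem PartitionFamily.measureHausdorffDim_le {P : ℕ → ℝ → Set ℝ} (hP : PartitionFamily P)
    (hS : SplitsAtomsInTwo P) {C : ℝ}
    (hC : 1 < C) {μ ν : Measure ℝ} [IsProbabilityMeasure μ] [IsProbabilityMeasure ν]
    (hν : ChildComparable P C ν)
    (hμc : μ (Set.Ico (0 : ℝ) 1) = 1) {a b : ℝ} (ha : 0 ≤ a) (hb : 0 < b)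
    (hA : ∀ᵐ x ∂μ, x ∈ Set.Ico (0 : ℝ) 1 →
      Tendsto (fun n : ℕ => -(Real.log ((μ (P n x)).toReal)) / n) atTop (nhds a))
    (hB : ∀ᵐ x ∂μ, x ∈ Set.Ico (0 : ℝ) 1 →
      Tendsto (fun n : ℕ => -(Real.log ((ν (P n x)).toReal)) / n) atTop (nhds b))
    (hνvol : ν = volume.restrict (Set.Ico (0 : ℝ) 1)) :
    measureHausdorffDim μ ≤ ENNReal.ofReal (a / b) := by
  have hvol : ∀ n, ∀ x ∈ Set.Ico (0 : ℝ) 1, volume (P n x) = ν (P n x) := by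
    intro n x hx
    rw [hνvol, Measure.restrict_apply (hP.measurableSet n hx),
      Set.inter_eq_left.2 (hP.subset_Ico n hx)]
  have hμI : ∀ᵐ x ∂μ, x ∈ Set.Ico (0 : ℝ) 1 := by
    rw [ae_iff, ← Set.compl_def]
    exact (prob_compl_eq_zero_iff measurableSet_Ico).2 hμc
  have hpos : ∀ᵐ x ∂μ, ∀ n, 0 < μ (P n x) := by
    refine ae_all_iff.2 fun n => ?_
    have hnull : μ (⋃ J ∈ {J | AtomOf P n J ∧ μ J = 0}, J) = 0 :=
      (measure_biUnion_null_iff ((hP.finite_atoms n).subset fun J hJ => hJ.1).countable).2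
        fun J hJ => hJ.2
    filter_upwards [hμI, measure_eq_zero_iff_ae_notMem.1 hnull] with x hx hxn
    refine pos_iff_ne_zero.2 fun h0 => hxn ?_
    exact Set.mem_biUnion (x := P n x) ⟨⟨x, hx, rfl⟩, h0⟩ (hP.mem_self n hx)
  have hgood : ∀ᵐ x ∂μ, x ∈ Set.Ico (0 : ℝ) 1 ∧ (∀ n, 0 < μ (P n x)) ∧
      Tendsto (fun n : ℕ => -(Real.log ((μ (P n x)).toReal)) / n) atTop (nhds a) ∧
      Tendsto (fun n : ℕ => -(Real.log ((ν (P n x)).toReal)) / n) atTop (nhds b) := by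
    filter_upwards [hμI, hpos, hA, hB] with x h1 h2 h3 h4 using ⟨h1, h2, h3 h1, h4 h1⟩
  obtain ⟨E, hEsub, hEm, hE1⟩ : ∃ E : Set ℝ, E ⊆ {x | x ∈ Set.Ico (0 : ℝ) 1 ∧
      (∀ n, 0 < μ (P n x)) ∧
      Tendsto (fun n : ℕ => -(Real.log ((μ (P n x)).toReal)) / n) atTop (nhds a) ∧
      Tendsto (fun n : ℕ => -(Real.log ((ν (P n x)).toReal)) / n) atTop (nhds b)} ∧
      MeasurableSet E ∧ μ E = 1 := by
    obtain ⟨T, hT, hTm, hT0⟩ := exists_measurable_superset_of_null (ae_iff.1 hgood)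
    refine ⟨Tᶜ, fun x hx => ?_, hTm.compl, (prob_compl_eq_one_iff hTm).2 hT0⟩
    by_contra hcon
    exact hx (hT hcon)
  have hdim : measureHausdorffDim μ ≤ dimH E :=
    iInf_le_of_le E (iInf_le_of_le hEm (iInf_le _ hE1))
  refine hdim.trans ?_
  refine ENNReal.le_of_forall_pos_le_add fun η hη _ => ?_
  set t : ℝ≥0 := Real.toNNReal (a / b) + η with ht
  have htpos : 0 < t := by positivity
  have htab : a < t * b := by
    have : (t : ℝ) = a / b + η := by
      rw [ht, NNReal.coe_add, Real.coe_toNNReal _ (by positivity)]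
    rw [this, add_mul, div_mul_cancel₀ _ hb.ne']
    have : 0 < (η : ℝ) * b := by positivity
    linarith
  have hcov : E ⊆ ⋃ k : ℕ, {x | x ∈ Set.Ico (0 : ℝ) 1 ∧
      ∀ n ≥ k, volume (P n x) ^ (t : ℝ) ≤ μ (P n x)} := by
    intro x hx
    obtain ⟨hxI, hxpos, hxa, hxb⟩ := hEsub hx
    have hev := hxa.eventually_lt (hxb.const_mul (t : ℝ)) htab
    obtain ⟨k, hk⟩ := eventually_atTop.1 (hev.and (eventually_gt_atTop 0))
    refine Set.mem_iUnion.2 ⟨k, hxI, fun n hn => ?_⟩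
    obtain ⟨h1, h2⟩ := hk n hn
    have hn0 : (0 : ℝ) < n := by exact_mod_cast h2
    rw [hvol n x hxI]
    rw [mul_div_assoc', div_lt_div_iff_of_pos_right hn0] at h1
    have hM : 0 < (μ (P n x)).toReal := ENNReal.toReal_pos (hxpos n).ne' (measure_ne_top _ _)
    rcases eq_or_ne (ν (P n x)) 0 with h0 | h0
    · rw [h0, ENNReal.zero_rpow_of_pos (by exact_mod_cast htpos)]
      exact zero_le
    have hV : 0 < (ν (P n x)).toReal := ENNReal.toReal_pos h0 (measure_ne_top _ _)
    rw [← ENNReal.toReal_le_toReal (ENNReal.rpow_ne_top_of_nonneg t.coe_nonneg (measure_ne_top _ _))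
      (measure_ne_top _ _), ← ENNReal.toReal_rpow, ← Real.log_le_log_iff (by positivity) hM,
      Real.log_rpow hV]
    linarith
  refine (dimH_mono hcov).trans ?_
  rw [dimH_iUnion]
  refine iSup_le fun k => ?_
  refine (hP.dimH_le_of_volume_rpow_le (PartitionFamily.tendsto_ofReal_pow hC)
    (fun n x hx => ?_) htpos k).trans_eq ?_
  · rw [hvol n x hx]
    exact hP.measure_le_pow hS hC hν n hx
  · rw [ht, ENNReal.coe_add]
    rfl

theorem le_measureHausdorffDim_of_tendsto_log_ball_div {μ : Measure ℝ} [IsProbabilityMeasure μ]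
    (hμc : μ (Set.Ico (0 : ℝ) 1) = 1) {s : ℝ} (h0 : μ {0} = 0)
    (h : ∀ᵐ x ∂μ, x ∈ Set.Ico (0 : ℝ) 1 →
      Tendsto (fun ε : ℝ =>
          Real.log ((μ (Set.Ioo (x - ε) (x + ε))).toReal) /
            Real.log ((volume.restrict (Set.Ico (0 : ℝ) 1) (Set.Ioo (x - ε) (x + ε))).toReal))
        (nhdsWithin 0 (Set.Ioi 0)) (nhds s)) :
    ENNReal.ofReal s ≤ measureHausdorffDim μ := by
  have hμI : ∀ᵐ x ∂μ, x ∈ Set.Ico (0 : ℝ) 1 := by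
    rw [ae_iff, ← Set.compl_def]
    exact (prob_compl_eq_zero_iff measurableSet_Ico).2 hμc
  refine le_iInf fun E => le_iInf fun _ => le_iInf fun hE => ?_
  refine ENNReal.le_of_forall_nnreal_lt fun r hr => ?_
  refine le_dimH_of_ae_measure_ball_le (μ := μ) ?_ (by simp [hE])
  filter_upwards [hμI, h, measure_eq_zero_iff_ae_notMem.1 h0] with x hxI hx hx0
  have hrs : (r : ℝ) < s := by
    rw [ENNReal.lt_ofReal_iff_toReal_lt ENNReal.coe_ne_top] at hr
    exact hr
  have hxpos : 0 < x := lt_of_le_of_ne hxI.1 fun h => hx0 h.symm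
  filter_upwards [(hx hxI).eventually_const_lt hrs,
    Ioo_mem_nhdsGT (lt_min (lt_min hxpos (sub_pos.2 hxI.2)) (by norm_num : (0 : ℝ) < 1 / 2))]
    with ε h1 hε
  have hε0 : 0 < ε := hε.1
  have hεx : ε < x := hε.2.trans_le ((min_le_left _ _).trans (min_le_left _ _))
  have hεx' : ε < 1 - x := hε.2.trans_le ((min_le_left _ _).trans (min_le_right _ _))
  have hε2 : ε < 1 / 2 := hε.2.trans_le (min_le_right _ _)
  have hsub : Set.Ioo (x - ε) (x + ε) ⊆ Set.Ico 0 1 :=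
    fun z hz => ⟨by linarith [hz.1], by linarith [hz.2]⟩
  rw [Measure.restrict_apply measurableSet_Ioo, Set.inter_eq_left.2 hsub, Real.volume_Ioo,
    (by ring : x + ε - (x - ε) = 2 * ε), ENNReal.toReal_ofReal (by positivity)] at h1
  have hlog : Real.log (2 * ε) < 0 := Real.log_neg (by positivity) (by linarith)
  rcases eq_or_ne (μ (Set.Ioo (x - ε) (x + ε))) 0 with hz | hz
  · simp [hz]
  have hM : 0 < (μ (Set.Ioo (x - ε) (x + ε))).toReal :=
    ENNReal.toReal_pos hz (measure_ne_top _ _)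
  rw [lt_div_iff_of_neg hlog, ← Real.log_rpow (by positivity),
    Real.log_lt_log_iff hM (by positivity)] at h1
  rw [ENNReal.ofReal_rpow_of_pos (by positivity)]
  exact (ENNReal.le_ofReal_iff_toReal_le (measure_ne_top _ _) (by positivity)).2 h1.le

/-- From the information content of nested dynamical partitions to local dimension:
under conditions (a)–(e), for `m`-a.e. `x ∈ [0,1)` one has
`log μ((x-ε,x+ε)) / log ν((x-ε,x+ε)) → a/b` as `ε → 0⁺`; in particular, if `m = μ` and
`ν` is Lebesgue measure on `[0,1)`, then `dim_H(μ) = a/b`. -/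
theorem local_dimension_from_partitions
    (P : ℕ → ℝ → Set ℝ) (hP : PartitionFamily P)
    (μ ν m : Measure ℝ)
    [IsProbabilityMeasure μ] [IsProbabilityMeasure ν] [IsProbabilityMeasure m]
    (hμc : μ (Set.Ico (0 : ℝ) 1) = 1) (hνc : ν (Set.Ico (0 : ℝ) 1) = 1)
    (hmc : m (Set.Ico (0 : ℝ) 1) = 1)
    (a b : ℝ) (ha : 0 ≤ a) (hb : 0 < b)
    -- (a)
    (hA : ∀ᵐ x ∂m, x ∈ Set.Ico (0 : ℝ) 1 →
      Tendsto (fun n : ℕ => -(Real.log ((μ (P n x)).toReal)) / n) atTop (nhds a))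
    -- (b)
    (hB : ∀ᵐ x ∂m, x ∈ Set.Ico (0 : ℝ) 1 →
      Tendsto (fun n : ℕ => -(Real.log ((ν (P n x)).toReal)) / n) atTop (nhds b))
    -- (c)
    (hc : ∃ C : ℝ, 1 < C ∧ ∀ n : ℕ, ∀ x ∈ Set.Ico (0 : ℝ) 1, ∀ y ∈ Set.Ico (0 : ℝ) 1,
      ∀ z ∈ Set.Ico (0 : ℝ) 1,
      P (n + 1) y ⊆ P n x → P (n + 1) z ⊆ P n x →
        μ (P (n + 1) y) / μ (P (n + 1) z) ≤ ENNReal.ofReal C ∧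
        μ (P n x) / μ (P (n + 1) y) ≤ ENNReal.ofReal C ∧
        ν (P (n + 1) y) / ν (P (n + 1) z) ≤ ENNReal.ofReal C ∧
        ν (P n x) / ν (P (n + 1) y) ≤ ENNReal.ofReal C ∧
        m (P n x) / m (P (n + 1) y) ≤ ENNReal.ofReal C)
    -- (d)
    (hd : ∀ᵐ x ∂m, x ∈ Set.Ico (0 : ℝ) 1 → (⋂ n : ℕ, P (n + 1) x) = {x})
    -- (e)
    (he : ∀ n : ℕ, ∀ x ∈ Set.Ico (0 : ℝ) 1, ∃ y ∈ Set.Ico (0 : ℝ) 1,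
      ∃ z ∈ Set.Ico (0 : ℝ) 1, ∃ w ∈ Set.Ico (0 : ℝ) 1,
      P (n + 1) y ⊆ P n x ∧ P (n + 1) z ⊆ P n x ∧ P (n + 1) w ⊆ P n x ∧
      P (n + 1) y ≠ P (n + 1) z ∧ P (n + 1) y ≠ P (n + 1) w ∧ P (n + 1) z ≠ P (n + 1) w) :
    (∀ᵐ x ∂m, x ∈ Set.Ico (0 : ℝ) 1 →
      Tendsto (fun ε : ℝ =>
          Real.log ((μ (Set.Ioo (x - ε) (x + ε))).toReal) /
            Real.log ((ν (Set.Ioo (x - ε) (x + ε))).toReal))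
        (nhdsWithin 0 (Set.Ioi 0)) (nhds (a / b))) ∧
    (m = μ → ν = volume.restrict (Set.Ico (0 : ℝ) 1) →
      measureHausdorffDim μ = ENNReal.ofReal (a / b)) := by
  obtain ⟨C, hC, hcmp⟩ := hc
  have hC0 : 0 ≤ C := by linarith
  have hμ : ChildComparable P C μ := fun n x hx y hy h =>
    measureReal_le_mul_of_div_le hC0 (hcmp n x hx y hy y hy h h).2.1
  have hν : ChildComparable P C ν := fun n x hx y hy h =>
    measureReal_le_mul_of_div_le hC0 (hcmp n x hx y hy y hy h h).2.2.2.1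
  have hm : ChildComparable P C m := fun n x hx y hy h =>
    measureReal_le_mul_of_div_le hC0 (hcmp n x hx y hy y hy h h).2.2.2.2
  have hS : SplitsAtomsInTwo P := fun n x hx => by
    obtain ⟨y, hy, z, hz, -, -, hyn, hzn, -, hyz, -⟩ := he n x hx
    exact ⟨y, hy, z, hz, hyn, hzn, hyz⟩
  have hlocal := hP.tendsto_log_ball_div_log_ball hS hC hμ hν hm hb hA hB hd
  refine ⟨hlocal, ?_⟩
  rintro rfl hvol
  refine le_antisymm (hP.measureHausdorffDim_le hS hC hν hμc ha hb hA hB hvol) ?_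
  rw [hvol] at hlocal
  exact le_measureHausdorffDim_of_tendsto_log_ball_div hμc
    (hP.measure_singleton hS hC hμ ⟨le_rfl, one_pos⟩) hlocal
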